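/- For every (X', y, z) ∈ Q' one has ℒφ(X', y, z) = (1/4) [ Lu(X', y+z) − Lu(X', y−z) − Lu(X', −y+z) + Lu(X', −y−z) ]; consequently sup_{Q'} |ℒφ| ≤ ‖Lu‖_{L∞(Q_d)}. -/

import Mathlib

open MeasureTheory Real
open scoped BigOperators ENNReal NNReal

noncomputable section

/-- First directional derivative of `g` at `x` in direction `e`. -/
def pd1 {W : Type*} [NormedAddCommGroup W] [NormedSpace ℝ W]
    (e : W) (g : W → ℝ) (x : W) : ℝ :=
  deriv (fun t : ℝ => g (x + t • e)) 0

/-- Second directional derivative of `g` at `x` in direction `e`. -/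
def pd2 {W : Type*} [NormedAddCommGroup W] [NormedSpace ℝ W]
    (e : W) (g : W → ℝ) (x : W) : ℝ :=
  deriv (deriv (fun t : ℝ => g (x + t • e))) 0

/-- Normalizing constant of the fractional Laplacian. -/
def fracC (N : ℕ) (s : ℝ) : ℝ :=
  2 ^ (2 * s - 1) * Real.Gamma (s + (N : ℝ) / 2) /
    (π ^ ((N : ℝ) / 2) * |Real.Gamma (-s)|)

/-- Constant `c̃_{N,s}`. -/
def ctilde (N : ℕ) (s : ℝ) : ℝ :=
  2 ^ s * Real.Gamma (s + 1) * Real.Gamma ((N : ℝ) / 2 + s) / Real.Gamma ((N : ℝ) / 2)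

/-- The integrand of the fractional Laplacian of order `s` acting through the embedding `inc`. -/
def fracKer {W : Type*} [NormedAddCommGroup W] [NormedSpace ℝ W]
    (N : ℕ) (s : ℝ) (inc : EuclideanSpace ℝ (Fin N) → W) (g : W → ℝ) (x : W)
    (y : EuclideanSpace ℝ (Fin N)) : ℝ :=
  (2 * g x - g (x + inc y) - g (x - inc y)) / ‖y‖ ^ ((N : ℝ) + 2 * s)

/-- Fractional Laplacian (`s ∈ (0,1)`) in the coordinates described by `inc`. -/
def fracLap {W : Type*} [NormedAddCommGroup W] [NormedSpace ℝ W]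
    (N : ℕ) (s : ℝ) (inc : EuclideanSpace ℝ (Fin N) → W) (g : W → ℝ) (x : W) : ℝ :=
  fracC N s * ∫ y : EuclideanSpace ℝ (Fin N), fracKer N s inc g x y

/-- Classical (negative) Laplacian in the coordinates described by `inc`. -/
def classLap {W : Type*} [NormedAddCommGroup W] [NormedSpace ℝ W]
    (N : ℕ) (inc : EuclideanSpace ℝ (Fin N) → W) (g : W → ℝ) (x : W) : ℝ :=
  -∑ j : Fin N, pd2 (inc (EuclideanSpace.single j 1)) g x

/-- `(-Δ)^s` in the coordinates described by `inc`, for `s ∈ (0,1]`. -/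
def sLap {W : Type*} [NormedAddCommGroup W] [NormedSpace ℝ W]
    (N : ℕ) (s : ℝ) (inc : EuclideanSpace ℝ (Fin N) → W) (g : W → ℝ) (x : W) : ℝ :=
  if s = 1 then classLap N inc g x else fracLap N s inc g x

/-- Sup norm on the whole space. -/
def supAbs {α : Type*} (g : α → ℝ) : ℝ := ⨆ x, |g x|

/-- Sup norm on a set. -/
def supAbsOn {α : Type*} (A : Set α) (g : α → ℝ) : ℝ := ⨆ x ∈ A, |g x|

/-- Hölder seminorm of exponent `γ` on a set. -/
def holderSemi {α : Type*} [NormedAddCommGroup α] (γ : ℝ) (A : Set α) (g : α → ℝ) : ℝ :=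
  ⨆ x ∈ A, ⨆ y ∈ A, |g x - g y| / ‖x - y‖ ^ γ

/-- Hölder norm `‖·‖_{C^γ(A)}`, `γ ∈ (0,1)`. -/
def holderNorm {α : Type*} [NormedAddCommGroup α] (γ : ℝ) (A : Set α) (g : α → ℝ) : ℝ :=
  supAbsOn A g + holderSemi γ A g

/-- `ℝ^{n-1}` split into the groups of variables `X_1,…,X_{m-1}`. -/
abbrev VS (m' : ℕ) (N : Fin m' → ℕ) : Type :=
  PiLp 2 (fun i : Fin m' => EuclideanSpace ℝ (Fin (N i)))

/-- `ℝ^n = ℝ^{n-1} × ℝ`, with the Euclidean norm. -/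
abbrev WS (m' : ℕ) (N : Fin m' → ℕ) : Type := WithLp 2 (VS m' N × ℝ)

variable (m' : ℕ) (N : Fin m' → ℕ)

/-- Build a point of `ℝ^n` from `X' ∈ ℝ^{n-1}` and a last coordinate `t`. -/
def toW (X' : VS m' N) (t : ℝ) : WS m' N := (WithLp.equiv 2 _).symm (X', t)

/-- The group `X_i` of coordinates of `x ∈ ℝⁿ`. -/
def Xc (x : WS m' N) : VS m' N := (WithLp.equiv 2 _ x).1

/-- The last coordinate `x_n` of `x ∈ ℝⁿ`. -/
def tc (x : WS m' N) : ℝ := (WithLp.equiv 2 _ x).2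

/-- The direction `e_n` of the last coordinate. -/
def lastE : WS m' N := toW m' N 0 1

/-- The increment `y^{(i)} ∈ ℝⁿ` induced by `y ∈ ℝ^{N_i}`. -/
def grpIncr (i : Fin m') (y : EuclideanSpace ℝ (Fin (N i))) : WS m' N :=
  (WithLp.equiv 2 _).symm ((WithLp.equiv 2 _).symm (Pi.single i y), 0)

/-- The operator `L = ∑ aᵢ (-Δ_{X_i})^{sᵢ} - ∂²_{x_n}`. -/
def Lop (a s : Fin m' → ℝ) (u : WS m' N → ℝ) (x : WS m' N) : ℝ :=
  (∑ i, a i * sLap (N i) (s i) (grpIncr m' N i) u x) - pd2 (lastE m' N) u x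

/-- The box `Q_d`. -/
def QdSet (d : Fin m' → ℝ) (dm : ℝ) : Set (WS m' N) :=
  {x | (∀ i, ‖Xc m' N x i‖ < d i) ∧ |tc m' N x| < dm}

/-- The constant `κ`. -/
def kap (a s d : Fin m' → ℝ) (dm : ℝ) (u : WS m' N → ℝ) : ℝ :=
  (4 / 3) * (supAbsOn (QdSet m' N d dm) (Lop m' N a s u)
    + (∑ i, supAbs u / (1 - (3 / 4 : ℝ) ^ (s i)) * (ctilde (N i) (s i) / (d i) ^ (2 * s i)))
    + supAbs u / (1 - (3 / 4 : ℝ) ^ (1 : ℝ)) * (ctilde 1 1 / dm ^ (2 : ℝ)))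

end

noncomputable section
variable (m' : ℕ) (N : Fin m' → ℕ)

/-- The extended space `ℝ^{n+1} = ℝ^{n-1}_{X'} × ℝ_y × ℝ_z`. -/
abbrev ES (m' : ℕ) (N : Fin m' → ℕ) : Type := VS m' N × ℝ × ℝ

/-- The increment `y^{(i)}` inside the extended space. -/
def grpIncrE (i : Fin m') (y : EuclideanSpace ℝ (Fin (N i))) : ES m' N :=
  ((WithLp.equiv 2 _).symm (Pi.single i y), 0, 0)

/-- The direction of the variable `y` in the extended space. -/
def eY : ES m' N := (0, 1, 0)

/-- The direction of the variable `z` in the extended space. -/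
def eZ : ES m' N := (0, 0, 1)

/-- The extended operator `ℒ = ∑ aᵢ (-Δ_{X_i})^{sᵢ} - (1/2)∂²_y - (1/2)∂²_z`. -/
def calL (a s : Fin m' → ℝ) (g : ES m' N → ℝ) (p : ES m' N) : ℝ :=
  (∑ i, a i * sLap (N i) (s i) (grpIncrE m' N i) g p)
    - (1 / 2) * pd2 (eY m' N) g p - (1 / 2) * pd2 (eZ m' N) g p

/-- The extended box `Q'`. -/
def QpSet (d : Fin m' → ℝ) (dm : ℝ) : Set (ES m' N) :=
  {p | (∀ i, ‖p.1 i‖ < d i / 2) ∧ p.2.1 ∈ Set.Ioo 0 (dm / 4) ∧ p.2.2 ∈ Set.Ioo 0 (dm / 4)}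

/-- The barrier `φ`. -/
def phiB (u : WS m' N → ℝ) (p : ES m' N) : ℝ :=
  (1 / 4) * (u (toW m' N p.1 (max p.2.1 0 + max p.2.2 0))
    - u (toW m' N p.1 (max p.2.1 0 - max p.2.2 0))
    - u (toW m' N p.1 (-max p.2.1 0 + max p.2.2 0))
    + u (toW m' N p.1 (-max p.2.1 0 - max p.2.2 0)))

/-- The barrier `ψ`. -/
def psiB (a s d : Fin m' → ℝ) (dm : ℝ) (u : WS m' N → ℝ) (p : ES m' N) : ℝ :=
  (∑ i, supAbs u / (1 - (3 / 4 : ℝ) ^ s i)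
      * (1 - (max (1 - ‖p.1 i‖ ^ 2 / d i ^ 2) 0) ^ s i))
    + 4 * supAbs (pd1 (lastE m' N) u) * (max p.2.1 0 * max p.2.2 0) / dm
    + kap m' N a s d dm u * max p.2.1 0 * max p.2.2 0
      * |Real.log (2 * dm / (max p.2.1 0 + max p.2.2 0))|

end

section Regularity

variable {W : Type*} [NormedAddCommGroup W] [NormedSpace ℝ W]

lemma pd2_eq_iteratedDeriv (e : W) (g : W → ℝ) (x : W) :
    pd2 e g x = iteratedDeriv 2 (fun t : ℝ => g (x + t • e)) 0 := by
  simp [pd2, iteratedDeriv_succ, iteratedDeriv_zero]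

lemma pd2_neg_dir (e : W) (g : W → ℝ) (x : W) : pd2 (-e) g x = pd2 e g x := by
  have h := iteratedDeriv_comp_neg 2 (fun t : ℝ => g (x + t • e)) 0
  simpa [pd2_eq_iteratedDeriv] using h

lemma ContDiffAt.comp_line {g : W → ℝ} {x : W} (hg : ContDiffAt ℝ 2 g x) (e : W) :
    ContDiffAt ℝ 2 (fun t : ℝ => g (x + t • e)) 0 := by
  refine ContDiffAt.comp (0 : ℝ) (g := g) (by simpa using hg) ?_
  fun_prop

lemma abs_pd2_le {g : W → ℝ} {x : W} (hg : ContDiffAt ℝ 2 g x) (e : W) :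
    |pd2 e g x| ≤ ‖fderiv ℝ (fderiv ℝ g) x‖ * ‖e‖ ^ 2 := by
  have hline : ∀ t : ℝ, HasDerivAt (fun t : ℝ => x + t • e) e t := fun t => by
    simpa using ((hasDerivAt_id t).smul_const e).const_add x
  have hcont : Filter.Tendsto (fun t : ℝ => x + t • e) (nhds 0) (nhds x) := by
    have : Continuous fun t : ℝ => x + t • e := by fun_prop
    simpa using this.tendsto 0
  have hderiv : deriv (fun t : ℝ => g (x + t • e)) =ᶠ[nhds 0]
      fun t => fderiv ℝ g (x + t • e) e := by
    filter_upwards [hcont.eventually (hg.eventually (by simp))] with t ht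
    exact ((ht.differentiableAt (by simp)).hasFDerivAt.comp_hasDerivAt t (hline t)).deriv
  have h2 : HasFDerivAt (fderiv ℝ g) (fderiv ℝ (fderiv ℝ g) x) (x + (0 : ℝ) • e) := by
    have : ContDiffAt ℝ 1 (fderiv ℝ g) x := hg.fderiv_right (by norm_num)
    simpa using (this.differentiableAt (by simp)).hasFDerivAt
  have h3 : HasDerivAt (fun t : ℝ => fderiv ℝ g (x + t • e)) (fderiv ℝ (fderiv ℝ g) x e) 0 :=
    h2.comp_hasDerivAt (0 : ℝ) (hline 0)
  have h4 : HasDerivAt (fun t : ℝ => fderiv ℝ g (x + t • e) e)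
      (fderiv ℝ (fderiv ℝ g) x e e) 0 := by
    simpa using h3.clm_apply (hasDerivAt_const (0 : ℝ) e)
  rw [pd2, hderiv.deriv_eq, h4.deriv, ← Real.norm_eq_abs]
  calc _ ≤ ‖fderiv ℝ (fderiv ℝ g) x e‖ * ‖e‖ := ContinuousLinearMap.le_opNorm _ _
    _ ≤ ‖fderiv ℝ (fderiv ℝ g) x‖ * ‖e‖ * ‖e‖ := by
      gcongr; exact ContinuousLinearMap.le_opNorm _ _
    _ = _ := by ring

/-- A second difference is controlled by the second derivative on a ball. -/
lemma abs_second_difference_le {g : W → ℝ} {x : W} {r C : ℝ}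
    (hg : ∀ w ∈ Metric.ball x r, ContDiffAt ℝ 2 g w)
    (hC : ∀ w ∈ Metric.ball x r, ‖fderiv ℝ (fderiv ℝ g) w‖ ≤ C)
    {h : W} (hh : ‖h‖ < r) :
    |2 * g x - g (x + h) - g (x - h)| ≤ 2 * C * ‖h‖ ^ 2 := by
  have hmem : ∀ t ∈ Set.Icc (0 : ℝ) 1, x + t • h ∈ Metric.ball x r ∧
      x - t • h ∈ Metric.ball x r := fun t ht => by
    have : ‖t • h‖ < r := by
      rw [norm_smul, Real.norm_of_nonneg ht.1]
      nlinarith [norm_nonneg h, ht.2]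
    constructor <;> simpa [dist_eq_norm] using this
  have hC0 : 0 ≤ C :=
    (norm_nonneg (fderiv ℝ (fderiv ℝ g) x)).trans (hC x (Metric.mem_ball_self ((norm_nonneg h).trans_lt hh)))
  have hderiv : ∀ t ∈ Set.Icc (0 : ℝ) 1, HasDerivAt (fun t : ℝ => g (x + t • h) + g (x - t • h))
      ((fderiv ℝ g (x + t • h) - fderiv ℝ g (x - t • h)) h) t := fun t ht => by
    have l1 : HasDerivAt (fun t : ℝ => x + t • h) h t := by
      simpa using ((hasDerivAt_id t).smul_const h).const_add x
    have l2 : HasDerivAt (fun t : ℝ => x - t • h) (-h) t := by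
      simpa using ((hasDerivAt_id t).smul_const h).const_sub x
    have d1 := ((hg _ (hmem t ht).1).differentiableAt (by simp)).hasFDerivAt.comp_hasDerivAt t l1
    have d2 := ((hg _ (hmem t ht).2).differentiableAt (by simp)).hasFDerivAt.comp_hasDerivAt t l2
    refine (d1.fun_add d2).congr_deriv ?_
    simp [sub_eq_add_neg]
  have hbound : ∀ t ∈ Set.Icc (0 : ℝ) 1,
      ‖(fderiv ℝ g (x + t • h) - fderiv ℝ g (x - t • h)) h‖ ≤ 2 * C * ‖h‖ ^ 2 := fun t ht => by
    have lip : ‖fderiv ℝ g (x + t • h) - fderiv ℝ g (x - t • h)‖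
        ≤ C * ‖x + t • h - (x - t • h)‖ :=
      Convex.norm_image_sub_le_of_norm_fderiv_le
        (fun w hw => ((hg w hw).fderiv_right (m := 1) (by norm_num)).differentiableAt (by simp))
        hC (convex_ball x r) (hmem t ht).2 (hmem t ht).1
    have e : ‖x + t • h - (x - t • h)‖ ≤ 2 * ‖h‖ := by
      have : x + t • h - (x - t • h) = (2 * t) • h := by module
      rw [this, norm_smul, Real.norm_of_nonneg (by linarith [ht.1])]
      nlinarith [norm_nonneg h, ht.2]
    calc _ ≤ ‖fderiv ℝ g (x + t • h) - fderiv ℝ g (x - t • h)‖ * ‖h‖ :=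
          ContinuousLinearMap.le_opNorm _ _
      _ ≤ C * (2 * ‖h‖) * ‖h‖ := by gcongr; exact lip.trans (by gcongr)
      _ = _ := by ring
  have key := Convex.norm_image_sub_le_of_norm_hasDerivWithin_le
    (fun t ht => (hderiv t ht).hasDerivWithinAt) hbound (convex_Icc (0 : ℝ) 1)
    (Set.left_mem_Icc.2 zero_le_one) (Set.right_mem_Icc.2 zero_le_one)
  simp only [one_smul, zero_smul, add_zero, sub_zero, norm_one, mul_one, Real.norm_eq_abs] at key
  calc _ = |g (x + h) + g (x - h) - (g x + g x)| := by rw [← abs_neg]; ring_nf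
    _ ≤ _ := key

end Regularity

section Kernel

/-- Radial majorant of the kernel of the fractional Laplacian. -/
noncomputable def fracMajorant (N : ℕ) (s r A B : ℝ) (ρ : ℝ) : ℝ :=
  if ρ < r then A * ρ ^ (2 - ((N : ℝ) + 2 * s)) else B * ρ ^ (-((N : ℝ) + 2 * s))

lemma integrable_fracMajorant {N : ℕ} (hN : 0 < N) {s : ℝ} (hs0 : 0 < s) (hs1 : s < 1)
    {r : ℝ} (hr : 0 < r) (A B : ℝ) :
    Integrable (fun y : EuclideanSpace ℝ (Fin N) => fracMajorant N s r A B ‖y‖) := by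
  have : Nonempty (Fin N) := ⟨⟨0, hN⟩⟩
  rw [integrable_fun_norm_addHaar, finrank_euclideanSpace_fin]
  have hpow : ∀ ρ : ℝ, 0 < ρ → ∀ b : ℝ,
      ρ ^ (N - 1) * ρ ^ (b - ((N : ℝ) + 2 * s)) = ρ ^ (b - 1 - 2 * s) := fun ρ hρ b => by
    rw [← Real.rpow_natCast, ← Real.rpow_add hρ, Nat.cast_sub hN]
    congr 1; push_cast; ring
  rw [← Set.Ioo_union_Ici_eq_Ioi hr, integrableOn_union]
  constructor
  · have h : IntegrableOn (fun ρ : ℝ => A * ρ ^ (2 - 1 - 2 * s)) (Set.Ioo 0 r) := by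
      refine Integrable.const_mul ?_ A
      rw [← IntegrableOn, ← integrableOn_Ioc_iff_integrableOn_Ioo,
        ← intervalIntegrable_iff_integrableOn_Ioc_of_le hr.le]
      exact intervalIntegral.intervalIntegrable_rpow' (by linarith)
    refine h.congr_fun (fun ρ hρ => ?_) measurableSet_Ioo
    simp only [fracMajorant, if_pos hρ.2, smul_eq_mul, ← hpow ρ hρ.1 2]
    ring
  · have h : IntegrableOn (fun ρ : ℝ => B * ρ ^ ((0 : ℝ) - 1 - 2 * s)) (Set.Ici r) := by
      refine Integrable.const_mul ?_ B
      rw [← IntegrableOn, integrableOn_Ici_iff_integrableOn_Ioi]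
      exact integrableOn_Ioi_rpow_of_lt (by linarith) hr
    refine h.congr_fun (fun ρ hρ => ?_) measurableSet_Ici
    have hρ' : r ≤ ρ := hρ
    simp only [fracMajorant, if_neg (not_lt.2 hρ'), smul_eq_mul]
    rw [← hpow ρ (hr.trans_le hρ') 0, zero_sub]
    ring

variable {W : Type*} [NormedAddCommGroup W] [NormedSpace ℝ W]

lemma abs_fracKer_le_fracMajorant {N : ℕ} {s : ℝ}
    (inc : EuclideanSpace ℝ (Fin N) → W) {g : W → ℝ} {x : W} {r A B : ℝ}
    (hnear : ∀ y, ‖y‖ < r → |2 * g x - g (x + inc y) - g (x - inc y)| ≤ A * ‖y‖ ^ 2)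
    (hfar : ∀ y, |2 * g x - g (x + inc y) - g (x - inc y)| ≤ B)
    {y : EuclideanSpace ℝ (Fin N)} (hy : y ≠ 0) :
    |fracKer N s inc g x y| ≤ fracMajorant N s r A B ‖y‖ := by
  have hpos : 0 < ‖y‖ := norm_pos_iff.2 hy
  rw [fracKer, abs_div, abs_of_pos (Real.rpow_pos_of_pos hpos _), fracMajorant]
  split_ifs with h
  · rw [Real.rpow_sub hpos, Real.rpow_two, ← mul_div_assoc]
    gcongr
    exact hnear y h
  · rw [Real.rpow_neg hpos.le, ← div_eq_mul_inv]
    gcongr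
    exact hfar y

lemma abs_fracLap_le {N : ℕ} (hN : 0 < N) {s : ℝ} (hs0 : 0 < s) (hs1 : s < 1)
    (inc : EuclideanSpace ℝ (Fin N) → W) {g : W → ℝ} {x : W} {r A B : ℝ} (hr : 0 < r)
    (hnear : ∀ y, ‖y‖ < r → |2 * g x - g (x + inc y) - g (x - inc y)| ≤ A * ‖y‖ ^ 2)
    (hfar : ∀ y, |2 * g x - g (x + inc y) - g (x - inc y)| ≤ B) :
    |fracLap N s inc g x| ≤
      |fracC N s| * ∫ y : EuclideanSpace ℝ (Fin N), fracMajorant N s r A B ‖y‖ := by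
  have : Nonempty (Fin N) := ⟨⟨0, hN⟩⟩
  rw [fracLap, abs_mul]
  gcongr
  rw [← Real.norm_eq_abs]
  refine norm_integral_le_of_norm_le (integrable_fracMajorant hN hs0 hs1 hr A B) ?_
  filter_upwards [Measure.ae_ne volume (0 : EuclideanSpace ℝ (Fin N))] with y hy
  exact abs_fracKer_le_fracMajorant inc hnear hfar hy

end Kernel

lemma norm_grpIncr (m' : ℕ) (N : Fin m' → ℕ) (i : Fin m') (y : EuclideanSpace ℝ (Fin (N i))) :
    ‖grpIncr m' N i y‖ = ‖y‖ := by
  have h1 := WithLp.norm_toLp_fst 2 (VS m' N) ℝ (WithLp.toLp 2 (Pi.single i y))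
  have h2 := PiLp.norm_single 2 (fun i : Fin m' => EuclideanSpace ℝ (Fin (N i))) i y
  exact h1.trans h2

lemma isBounded_QdSet (m' : ℕ) (N : Fin m' → ℕ) (d : Fin m' → ℝ) (dm : ℝ) :
    Bornology.IsBounded (QdSet m' N d dm) := by
  have hX := (PiLp.antilipschitzWith_ofLp 2
    (fun i : Fin m' => EuclideanSpace ℝ (Fin (N i)))).isBounded_preimage
    (Bornology.IsBounded.pi fun i => Metric.isBounded_ball (x := (0 : EuclideanSpace ℝ (Fin (N i))))
      (r := d i))
  refine ((WithLp.prod_antilipschitzWith_ofLp 2 (VS m' N) ℝ).isBounded_preimage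
    (hX.prod (Metric.isBounded_ball (x := (0 : ℝ)) (r := dm)))).subset fun x hx => ?_
  refine ⟨fun i _ => ?_, ?_⟩
  · exact mem_ball_zero_iff.2 (hx.1 i)
  · exact mem_ball_zero_iff.2 hx.2

lemma exists_abs_Lop_le {m' : ℕ} {N : Fin m' → ℕ} (hN : ∀ i, 0 < N i) (a : Fin m' → ℝ)
    {s : Fin m' → ℝ} (hs : ∀ i, s i ∈ Set.Ioc (0 : ℝ) 1) (d : Fin m' → ℝ) (dm : ℝ)
    {u : WS m' N → ℝ} (hu_bdd : ∃ M, ∀ x, |u x| ≤ M)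
    (hu_C2 : ∃ U : Set (WS m' N), IsOpen U ∧ closure (QdSet m' N d dm) ⊆ U ∧
      ContDiffOn ℝ 2 u U) :
    ∃ B, ∀ x ∈ QdSet m' N d dm, |Lop m' N a s u x| ≤ B := by
  obtain ⟨M, hM⟩ := hu_bdd
  obtain ⟨U, hU, hQU, hu⟩ := hu_C2
  have hK := (isBounded_QdSet m' N d dm).isCompact_closure
  obtain ⟨r, hr, hrU⟩ := hK.exists_cthickening_subset_open hU hQU
  have hD2 : ContinuousOn (fderiv ℝ (fderiv ℝ u)) U :=
    (hu.fderiv_of_isOpen hU (m := 1) (by norm_num)).continuousOn_fderiv_of_isOpen hU le_rfl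
  obtain ⟨C, hC⟩ : ∃ C, ∀ x ∈ Metric.cthickening r (closure (QdSet m' N d dm)),
      ‖fderiv ℝ (fderiv ℝ u) x‖ ≤ C :=
    (hK.cthickening (r := r)).exists_bound_of_continuousOn (f := fderiv ℝ (fderiv ℝ u))
      (hD2.mono hrU)
  have hball : ∀ x ∈ QdSet m' N d dm,
      Metric.ball x r ⊆ Metric.cthickening r (closure (QdSet m' N d dm)) := fun x hx =>
    (Metric.ball_subset_thickening (subset_closure hx) r).trans
      (Metric.thickening_subset_cthickening _ _)
  have hdiff : ∀ w ∈ U, ContDiffAt ℝ 2 u w := fun w hw => hu.contDiffAt (hU.mem_nhds hw)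
  have hpd2 : ∀ x ∈ QdSet m' N d dm, ∀ e, |pd2 e u x| ≤ C * ‖e‖ ^ 2 := fun x hx e =>
    (abs_pd2_le (hdiff x (hQU (subset_closure hx))) e).trans <| by
      gcongr; exact hC x (hball x hx (Metric.mem_ball_self hr))
  have hsLap : ∀ i, ∃ B, ∀ x ∈ QdSet m' N d dm,
      |sLap (N i) (s i) (grpIncr m' N i) u x| ≤ B := by
    intro i
    by_cases h1 : s i = 1
    · refine ⟨∑ j, C * ‖grpIncr m' N i (EuclideanSpace.single j 1)‖ ^ 2, fun x hx => ?_⟩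
      rw [sLap, if_pos h1, classLap, abs_neg]
      exact (Finset.abs_sum_le_sum_abs _ _).trans (Finset.sum_le_sum fun j _ => hpd2 x hx _)
    · refine ⟨|fracC (N i) (s i)| * ∫ y : EuclideanSpace ℝ (Fin (N i)),
        fracMajorant (N i) (s i) r (2 * C) (4 * M) ‖y‖, fun x hx => ?_⟩
      rw [sLap, if_neg h1]
      refine abs_fracLap_le (hN i) (hs i).1 (lt_of_le_of_ne (hs i).2 h1) _ hr
        (fun y hy => ?_) (fun y => ?_)
      · rw [← norm_grpIncr m' N i y] at hy ⊢
        exact abs_second_difference_le (fun w hw => hdiff w (hrU (hball x hx hw)))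
          (fun w hw => hC w (hball x hx hw)) hy
      · have b0 := abs_le.1 (hM x)
        have b1 := abs_le.1 (hM (x + grpIncr m' N i y))
        have b2 := abs_le.1 (hM (x - grpIncr m' N i y))
        exact abs_le.2 ⟨by linarith, by linarith⟩
  choose B hB using hsLap
  refine ⟨∑ i, |a i| * B i + C * ‖lastE m' N‖ ^ 2, fun x hx => ?_⟩
  refine (abs_sub _ _).trans (add_le_add ?_ (hpd2 x hx _))
  refine (Finset.abs_sum_le_sum_abs _ _).trans (Finset.sum_le_sum fun i _ => ?_)
  rw [abs_mul]
  gcongr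
  exact hB i x hx

section SupAbsOn

variable {α : Type*}

lemma supAbsOn_nonneg (A : Set α) (g : α → ℝ) : 0 ≤ supAbsOn A g :=
  Real.iSup_nonneg fun _ => Real.iSup_nonneg fun _ => abs_nonneg _

lemma supAbsOn_le {A : Set α} {g : α → ℝ} {B : ℝ} (hB : 0 ≤ B) (h : ∀ x ∈ A, |g x| ≤ B) :
    supAbsOn A g ≤ B :=
  Real.iSup_le (fun x => Real.iSup_le (fun hx => h x hx) hB) hB

lemma abs_le_supAbsOn {A : Set α} {g : α → ℝ} {B : ℝ} (h : ∀ x ∈ A, |g x| ≤ B) {x : α}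
    (hx : x ∈ A) : |g x| ≤ supAbsOn A g := by
  have hbdd : BddAbove (Set.range fun x => ⨆ _ : x ∈ A, |g x|) := by
    refine ⟨B, ?_⟩
    rintro _ ⟨z, rfl⟩
    exact Real.iSup_le (fun hz => h z hz) ((abs_nonneg _).trans (h x hx))
  have := le_ciSup hbdd x
  simpa [supAbsOn, hx] using this

end SupAbsOn

section Symmetrization

variable {m' : ℕ} {N : Fin m' → ℕ}

lemma toW_add_grpIncr (X : VS m' N) (t : ℝ) (i : Fin m') (y : EuclideanSpace ℝ (Fin (N i)))
    (c : ℝ) :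
    toW m' N X t + c • grpIncr m' N i y = toW m' N (X + c • (grpIncrE m' N i y).1) t := by
  simp [toW, grpIncr, grpIncrE, ← WithLp.toLp_smul, ← WithLp.toLp_add]

lemma toW_add_lastE (X : VS m' N) (t c : ℝ) :
    toW m' N X t + c • lastE m' N = toW m' N X (t + c) := by
  simp [toW, lastE, ← WithLp.toLp_smul, ← WithLp.toLp_add]

lemma phiB_of_nonneg (u : WS m' N → ℝ) (X : VS m' N) {y z : ℝ} (hy : 0 ≤ y) (hz : 0 ≤ z) :
    phiB m' N u (X, y, z) = (1 / 4) * (u (toW m' N X (y + z)) - u (toW m' N X (y - z))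
      - u (toW m' N X (-y + z)) + u (toW m' N X (-y - z))) := by
  simp [phiB, max_eq_left hy, max_eq_left hz]

/-- The second derivative of `φ` along a line on which `φ` is, to second order, the
symmetrization of `u` along four lines. -/
lemma pd2_phiB_of_eventuallyEq {u : WS m' N → ℝ} {p e : ES m' N} {x₁ x₂ x₃ x₄ e₁ e₂ e₃ e₄ : WS m' N}
    (h₁ : ContDiffAt ℝ 2 u x₁) (h₂ : ContDiffAt ℝ 2 u x₂) (h₃ : ContDiffAt ℝ 2 u x₃)
    (h₄ : ContDiffAt ℝ 2 u x₄)
    (h : (fun t : ℝ => phiB m' N u (p + t • e)) =ᶠ[nhds 0] fun t : ℝ =>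
      (1 / 4) * (u (x₁ + t • e₁) - u (x₂ + t • e₂) - u (x₃ + t • e₃) + u (x₄ + t • e₄))) :
    pd2 e (phiB m' N u) p =
      (1 / 4) * (pd2 e₁ u x₁ - pd2 e₂ u x₂ - pd2 e₃ u x₃ + pd2 e₄ u x₄) := by
  simp only [pd2_eq_iteratedDeriv]
  have c₁ := h₁.comp_line e₁
  have c₂ := h₂.comp_line e₂
  have c₃ := h₃.comp_line e₃
  have c₄ := h₄.comp_line e₄
  rw [h.iteratedDeriv_eq, iteratedDeriv_const_mul_field,
    iteratedDeriv_fun_add ((c₁.sub c₂).sub c₃) c₄, iteratedDeriv_fun_sub (c₁.sub c₂) c₃,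
    iteratedDeriv_fun_sub c₁ c₂]

lemma phiB_add_grpIncrE (u : WS m' N → ℝ) (X : VS m' N) {y z : ℝ} (hy : 0 ≤ y) (hz : 0 ≤ z)
    (i : Fin m') (w : EuclideanSpace ℝ (Fin (N i))) (c : ℝ) :
    phiB m' N u ((X, y, z) + c • grpIncrE m' N i w) =
      (1 / 4) * (u (toW m' N X (y + z) + c • grpIncr m' N i w)
        - u (toW m' N X (y - z) + c • grpIncr m' N i w)
        - u (toW m' N X (-y + z) + c • grpIncr m' N i w)
        + u (toW m' N X (-y - z) + c • grpIncr m' N i w)) := by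
  simp only [toW_add_grpIncr]
  rw [← phiB_of_nonneg u _ hy hz]
  simp [grpIncrE]

lemma sLap_phiB {u : WS m' N → ℝ} {X : VS m' N} {y z : ℝ} (hy : 0 ≤ y) (hz : 0 ≤ z) {i : Fin m'}
    {σ : ℝ} {S : Set (WS m' N)} (hC : ∀ x ∈ S, ContDiffAt ℝ 2 u x)
    (hint : σ ≠ 1 → ∀ x ∈ S, Integrable (fracKer (N i) σ (grpIncr m' N i) u x))
    (h₁ : toW m' N X (y + z) ∈ S) (h₂ : toW m' N X (y - z) ∈ S)
    (h₃ : toW m' N X (-y + z) ∈ S) (h₄ : toW m' N X (-y - z) ∈ S) :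
    sLap (N i) σ (grpIncrE m' N i) (phiB m' N u) (X, y, z) =
      (1 / 4) * (sLap (N i) σ (grpIncr m' N i) u (toW m' N X (y + z))
        - sLap (N i) σ (grpIncr m' N i) u (toW m' N X (y - z))
        - sLap (N i) σ (grpIncr m' N i) u (toW m' N X (-y + z))
        + sLap (N i) σ (grpIncr m' N i) u (toW m' N X (-y - z))) := by
  by_cases hσ : σ = 1
  · simp only [sLap, if_pos hσ, classLap]
    have : ∀ j : Fin (N i), pd2 (grpIncrE m' N i (EuclideanSpace.single j 1)) (phiB m' N u)
        (X, y, z) = _ := fun j =>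
      pd2_phiB_of_eventuallyEq (hC _ h₁) (hC _ h₂) (hC _ h₃) (hC _ h₄)
        (Filter.Eventually.of_forall fun t => phiB_add_grpIncrE u X hy hz i _ t)
    simp only [this, ← Finset.mul_sum, Finset.sum_add_distrib, Finset.sum_sub_distrib]
    ring
  · simp only [sLap, if_neg hσ, fracLap]
    have hker : fracKer (N i) σ (grpIncrE m' N i) (phiB m' N u) (X, y, z) = fun w =>
        (1 / 4) * (fracKer (N i) σ (grpIncr m' N i) u (toW m' N X (y + z)) w
          - fracKer (N i) σ (grpIncr m' N i) u (toW m' N X (y - z)) w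
          - fracKer (N i) σ (grpIncr m' N i) u (toW m' N X (-y + z)) w
          + fracKer (N i) σ (grpIncr m' N i) u (toW m' N X (-y - z)) w) := by
      funext w
      have e1 := phiB_add_grpIncrE u X hy hz i w 1
      have e2 := phiB_add_grpIncrE u X hy hz i w (-1)
      simp only [one_smul, neg_smul, ← sub_eq_add_neg] at e1 e2
      simp only [fracKer, e1, e2, phiB_of_nonneg u X hy hz]
      ring
    have i₁ := hint hσ _ h₁
    have i₂ := hint hσ _ h₂
    have i₃ := hint hσ _ h₃
    have i₄ := hint hσ _ h₄
    have i₁₂ : Integrable fun w => fracKer (N i) σ (grpIncr m' N i) u (toW m' N X (y + z)) w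
        - fracKer (N i) σ (grpIncr m' N i) u (toW m' N X (y - z)) w := i₁.sub i₂
    rw [hker, integral_const_mul, integral_add (i₁₂.sub' i₃) i₄, integral_sub i₁₂ i₃,
      integral_sub i₁ i₂]
    ring

lemma pd2_eY_phiB {u : WS m' N → ℝ} {X : VS m' N} {y z : ℝ} (hy : 0 < y) (hz : 0 ≤ z)
    {S : Set (WS m' N)} (hC : ∀ x ∈ S, ContDiffAt ℝ 2 u x)
    (h₁ : toW m' N X (y + z) ∈ S) (h₂ : toW m' N X (y - z) ∈ S)
    (h₃ : toW m' N X (-y + z) ∈ S) (h₄ : toW m' N X (-y - z) ∈ S) :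
    pd2 (eY m' N) (phiB m' N u) (X, y, z) =
      (1 / 4) * (pd2 (lastE m' N) u (toW m' N X (y + z)) - pd2 (lastE m' N) u (toW m' N X (y - z))
        - pd2 (lastE m' N) u (toW m' N X (-y + z))
        + pd2 (lastE m' N) u (toW m' N X (-y - z))) := by
  rw [← pd2_neg_dir (lastE m' N) u (toW m' N X (-y + z)),
    ← pd2_neg_dir (lastE m' N) u (toW m' N X (-y - z))]
  refine pd2_phiB_of_eventuallyEq (hC _ h₁) (hC _ h₂) (hC _ h₃) (hC _ h₄) ?_
  filter_upwards [Ioi_mem_nhds (neg_lt_zero.2 hy)] with t ht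
  have ht' : 0 ≤ y + t := by linarith [Set.mem_Ioi.1 ht]
  have e : (X, y, z) + t • eY m' N = (X, y + t, z) := by simp [eY]
  rw [e, phiB_of_nonneg u X ht' hz]
  simp only [smul_neg, ← neg_smul, toW_add_lastE]
  ring_nf

lemma pd2_eZ_phiB {u : WS m' N → ℝ} {X : VS m' N} {y z : ℝ} (hy : 0 ≤ y) (hz : 0 < z)
    {S : Set (WS m' N)} (hC : ∀ x ∈ S, ContDiffAt ℝ 2 u x)
    (h₁ : toW m' N X (y + z) ∈ S) (h₂ : toW m' N X (y - z) ∈ S)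
    (h₃ : toW m' N X (-y + z) ∈ S) (h₄ : toW m' N X (-y - z) ∈ S) :
    pd2 (eZ m' N) (phiB m' N u) (X, y, z) =
      (1 / 4) * (pd2 (lastE m' N) u (toW m' N X (y + z)) - pd2 (lastE m' N) u (toW m' N X (y - z))
        - pd2 (lastE m' N) u (toW m' N X (-y + z))
        + pd2 (lastE m' N) u (toW m' N X (-y - z))) := by
  rw [← pd2_neg_dir (lastE m' N) u (toW m' N X (y - z)),
    ← pd2_neg_dir (lastE m' N) u (toW m' N X (-y - z))]
  refine pd2_phiB_of_eventuallyEq (hC _ h₁) (hC _ h₂) (hC _ h₃) (hC _ h₄) ?_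
  filter_upwards [Ioi_mem_nhds (neg_lt_zero.2 hz)] with t ht
  have ht' : 0 ≤ z + t := by linarith [Set.mem_Ioi.1 ht]
  have e : (X, y, z) + t • eZ m' N = (X, y, z + t) := by simp [eZ]
  rw [e, phiB_of_nonneg u X hy ht']
  simp only [smul_neg, ← neg_smul, toW_add_lastE]
  ring_nf

lemma calL_phiB {a s : Fin m' → ℝ} {u : WS m' N → ℝ} {X : VS m' N} {y z : ℝ}
    (hy : 0 < y) (hz : 0 < z) {S : Set (WS m' N)} (hC : ∀ x ∈ S, ContDiffAt ℝ 2 u x)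
    (hint : ∀ i, s i ≠ 1 → ∀ x ∈ S, Integrable (fracKer (N i) (s i) (grpIncr m' N i) u x))
    (h₁ : toW m' N X (y + z) ∈ S) (h₂ : toW m' N X (y - z) ∈ S)
    (h₃ : toW m' N X (-y + z) ∈ S) (h₄ : toW m' N X (-y - z) ∈ S) :
    calL m' N a s (phiB m' N u) (X, y, z) =
      (1 / 4) * (Lop m' N a s u (toW m' N X (y + z)) - Lop m' N a s u (toW m' N X (y - z))
        - Lop m' N a s u (toW m' N X (-y + z)) + Lop m' N a s u (toW m' N X (-y - z))) := by
  have hsum : ∑ i, a i * sLap (N i) (s i) (grpIncrE m' N i) (phiB m' N u) (X, y, z) =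
      (1 / 4) * (∑ i, a i * sLap (N i) (s i) (grpIncr m' N i) u (toW m' N X (y + z))
        - ∑ i, a i * sLap (N i) (s i) (grpIncr m' N i) u (toW m' N X (y - z))
        - ∑ i, a i * sLap (N i) (s i) (grpIncr m' N i) u (toW m' N X (-y + z))
        + ∑ i, a i * sLap (N i) (s i) (grpIncr m' N i) u (toW m' N X (-y - z))) := by
    simp only [← Finset.sum_sub_distrib, ← Finset.sum_add_distrib, Finset.mul_sum]
    refine Finset.sum_congr rfl fun i _ => ?_
    rw [sLap_phiB hy.le hz.le hC (hint i) h₁ h₂ h₃ h₄]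
    ring
  rw [calL, hsum, pd2_eY_phiB hy hz.le hC h₁ h₂ h₃ h₄, pd2_eZ_phiB hy.le hz hC h₁ h₂ h₃ h₄]
  simp only [Lop]
  ring

lemma toW_mem_QdSet {d : Fin m' → ℝ} (hd : ∀ i, 0 < d i) {dm : ℝ} {X : VS m' N} {t : ℝ}
    (hX : ∀ i, ‖X i‖ < d i / 2) (ht : |t| < dm) : toW m' N X t ∈ QdSet m' N d dm :=
  ⟨fun i => (hX i).trans (half_lt_self (hd i)), ht⟩

end Symmetrization

/-- **Extended equation for `φ`.** For every `(X',y,z) ∈ Q'`,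
`ℒφ(X',y,z) = (1/4)[Lu(X',y+z) - Lu(X',y-z) - Lu(X',-y+z) + Lu(X',-y-z)]`;
consequently `sup_{Q'} |ℒφ| ≤ ‖Lu‖_{L∞(Q_d)}`. -/
theorem extended_operator_phi
    (m' : ℕ) (hm' : 1 ≤ m') (N : Fin m' → ℕ) (hN : ∀ i, 0 < N i)
    (a : Fin m' → ℝ) (ha : ∀ i, 0 ≤ a i)
    (s : Fin m' → ℝ) (hs : ∀ i, s i ∈ Set.Ioc (0 : ℝ) 1)
    (d : Fin m' → ℝ) (hd : ∀ i, 0 < d i) (dm : ℝ) (hdm : 0 < dm)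
    (u : WS m' N → ℝ)
    (hu_bdd : ∃ M, ∀ x, |u x| ≤ M)
    (hu_cont : Continuous u)
    (hu_C2 : ∃ U : Set (WS m' N), IsOpen U ∧ closure (QdSet m' N d dm) ⊆ U ∧
      ContDiffOn ℝ 2 u U)
    (hu_int : ∀ x ∈ QdSet m' N d dm, ∀ i, s i < 1 →
      Integrable (fracKer (N i) (s i) (grpIncr m' N i) u x)) :
    (∀ p ∈ QpSet m' N d dm,
      calL m' N a s (phiB m' N u) p =
        (1 / 4) * (Lop m' N a s u (toW m' N p.1 (p.2.1 + p.2.2))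
          - Lop m' N a s u (toW m' N p.1 (p.2.1 - p.2.2))
          - Lop m' N a s u (toW m' N p.1 (-p.2.1 + p.2.2))
          + Lop m' N a s u (toW m' N p.1 (-p.2.1 - p.2.2)))) ∧
    supAbsOn (QpSet m' N d dm) (calL m' N a s (phiB m' N u))
      ≤ supAbsOn (QdSet m' N d dm) (Lop m' N a s u) := by
  have hmem : ∀ p ∈ QpSet m' N d dm,
      toW m' N p.1 (p.2.1 + p.2.2) ∈ QdSet m' N d dm ∧
      toW m' N p.1 (p.2.1 - p.2.2) ∈ QdSet m' N d dm ∧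
      toW m' N p.1 (-p.2.1 + p.2.2) ∈ QdSet m' N d dm ∧
      toW m' N p.1 (-p.2.1 - p.2.2) ∈ QdSet m' N d dm := by
    rintro ⟨X, y, z⟩ ⟨hX, ⟨hy0, hy1⟩, ⟨hz0, hz1⟩⟩
    dsimp only at hX hy0 hy1 hz0 hz1 ⊢
    refine ⟨toW_mem_QdSet hd hX ?_, toW_mem_QdSet hd hX ?_, toW_mem_QdSet hd hX ?_,
      toW_mem_QdSet hd hX ?_⟩ <;> exact abs_lt.2 ⟨by linarith, by linarith⟩
  have hC : ∀ x ∈ QdSet m' N d dm, ContDiffAt ℝ 2 u x := by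
    obtain ⟨U, hU, hQU, hu⟩ := hu_C2
    exact fun x hx => hu.contDiffAt (hU.mem_nhds (hQU (subset_closure hx)))
  have heq : ∀ p ∈ QpSet m' N d dm, _ := fun p hp =>
    calL_phiB (a := a) (s := s) hp.2.1.1 hp.2.2.1 hC
      (fun i hi x hx => hu_int x hx i (lt_of_le_of_ne (hs i).2 hi))
      (hmem p hp).1 (hmem p hp).2.1 (hmem p hp).2.2.1 (hmem p hp).2.2.2
  refine ⟨heq, supAbsOn_le (supAbsOn_nonneg _ _) fun p hp => ?_⟩
  obtain ⟨B, hB⟩ := exists_abs_Lop_le hN a hs d dm hu_bdd hu_C2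
  obtain ⟨m₁, m₂, m₃, m₄⟩ := hmem p hp
  have b₁ := abs_le.1 (abs_le_supAbsOn hB m₁)
  have b₂ := abs_le.1 (abs_le_supAbsOn hB m₂)
  have b₃ := abs_le.1 (abs_le_supAbsOn hB m₃)
  have b₄ := abs_le.1 (abs_le_supAbsOn hB m₄)
  refine (congrArg abs (heq p hp)).trans_le (abs_le.2 ⟨?_, ?_⟩) <;> linarith
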